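/- Let f : (k+1)^V → ℝ be a nonnegative monotone k-submodular function with f(0) = 0, let c be a cost function on V, and let B > 0 be a budget. Then every output s of the 1-Guess Greedy algorithm with budget B (under arbitrary tie-breaking) satisfies c(s) ≤ B and 2·f(s) ≥ max{ f(x) : x ∈ (k+1)^V, c(x) ≤ B }. -/

import Mathlib

open Finset

section KSubmodularDefs

variable {V : Type*} [Fintype V] [DecidableEq V] {k : ℕ}

/-- The support of a `k`-tuple `x : V → Fin (k+1)` (value `0` means "not selected"). -/
def ksupp (x : V → Fin (k+1)) : Finset V := Finset.univ.filter fun e => x e ≠ 0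

/-- The meet `x ⊓ y`. -/
def kinf (x y : V → Fin (k+1)) : V → Fin (k+1) :=
  fun e => if x e = y e then x e else 0

/-- The join `x ⊔ y`. -/
def ksup (x y : V → Fin (k+1)) : V → Fin (k+1) :=
  fun e => if y e = 0 ∨ y e = x e then x e else if x e = 0 then y e else 0

/-- `f` is `k`-submodular. -/
def KSubmodular (f : (V → Fin (k+1)) → ℝ) : Prop :=
  ∀ x y : V → Fin (k+1), f (ksup x y) + f (kinf x y) ≤ f x + f y

/-- The partial order `x ⪯ y` on `(k+1)^V`. -/
def kle (x y : V → Fin (k+1)) : Prop := ∀ e : V, x e = 0 ∨ x e = y e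

/-- `f` is monotone with respect to `⪯`. -/
def KMonotone (f : (V → Fin (k+1)) → ℝ) : Prop :=
  ∀ x y : V → Fin (k+1), kle x y → f x ≤ f y

/-- The marginal gain `Δ_{e,j}(x)` of assigning element `e` to component `j`. -/
def margin (f : (V → Fin (k+1)) → ℝ) (x : V → Fin (k+1)) (e : V) (j : Fin (k+1)) : ℝ :=
  f (Function.update x e j) - f x

/-- The total cost `c(x)` of a tuple. -/
def kcost (c : V → ℝ) (x : V → Fin (k+1)) : ℝ := ∑ e ∈ ksupp x, c e

/-- One step of a greedy sequence relative to `o`: pick `e ∉ supp x` and `j ∈ {1,…,k}`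
maximizing the marginal gain over components (a), and with marginal density at least that of
every pair `(e', j')` with `e' ∈ supp o \ supp x` (b). -/
def GreedyStep (f : (V → Fin (k+1)) → ℝ) (c : V → ℝ) (o : V → Fin (k+1))
    (x x' : V → Fin (k+1)) : Prop :=
  ∃ e : V, ∃ j : Fin (k+1), x e = 0 ∧ j ≠ 0 ∧ x' = Function.update x e j ∧
    (∀ j' : Fin (k+1), j' ≠ 0 → margin f x e j' ≤ margin f x e j) ∧
    (∀ e' : V, o e' ≠ 0 → x e' = 0 → ∀ j' : Fin (k+1), j' ≠ 0 →
      margin f x e' j' * c e ≤ margin f x e j * c e')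

/-- `GreedyRun f c B s V0 out`: starting from partial solution `s` with remaining elements `V0`,
the greedy procedure with budget `B` (under some tie-breaking) can terminate with output `out`.
At each step a pair `(e, j)` of maximum marginal density among remaining elements is chosen;
`e` is added (placed in component `j`) iff it fits in the remaining budget, and is removed
from the remaining pool in either case. -/
inductive GreedyRun (f : (V → Fin (k+1)) → ℝ) (c : V → ℝ) (B : ℝ) :
    (V → Fin (k+1)) → Finset V → (V → Fin (k+1)) → Prop where
  | done (s : V → Fin (k+1)) : GreedyRun f c B s ∅ s
  | take (s : V → Fin (k+1)) (V0 : Finset V) (e : V) (j : Fin (k+1))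
      (out : V → Fin (k+1)) (he : e ∈ V0) (hj : j ≠ 0)
      (hbest : ∀ e' ∈ V0, ∀ j' : Fin (k+1), j' ≠ 0 →
        margin f s e' j' / c e' ≤ margin f s e j / c e)
      (hfit : kcost c s + c e ≤ B)
      (hrest : GreedyRun f c B (Function.update s e j) (V0.erase e) out) :
      GreedyRun f c B s V0 out
  | skip (s : V → Fin (k+1)) (V0 : Finset V) (e : V) (j : Fin (k+1))
      (out : V → Fin (k+1)) (he : e ∈ V0) (hj : j ≠ 0)
      (hbest : ∀ e' ∈ V0, ∀ j' : Fin (k+1), j' ≠ 0 →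
        margin f s e' j' / c e' ≤ margin f s e j / c e)
      (hnofit : ¬ kcost c s + c e ≤ B)
      (hrest : GreedyRun f c B s (V0.erase e) out) :
      GreedyRun f c B s V0 out

/-- The `k`-multilinear extension of `f`, as a function of `x : V → Fin (k+1) → ℝ`
(only the coordinates `x e j` with `j ≠ 0` are relevant). -/
noncomputable def kext (f : (V → Fin (k+1)) → ℝ) (x : V → Fin (k+1) → ℝ) : ℝ :=
  ∑ s : V → Fin (k+1), f s *
    ∏ e : V,
      (if s e = 0 then 1 - ∑ j ∈ Finset.univ.erase (0 : Fin (k+1)), x e j else x e (s e))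

/-- The partial derivative of `F` with respect to the coordinate `(e, j)` at the point `x`. -/
noncomputable def pderiv (F : (V → Fin (k+1) → ℝ) → ℝ) (e : V) (j : Fin (k+1))
    (x : V → Fin (k+1) → ℝ) : ℝ :=
  deriv (fun t : ℝ => F (Function.update x e (Function.update (x e) j t))) (x e j)

/-- Membership in the domain `Δ_k^V` of the multilinear extension. -/
def inSimplex (x : V → Fin (k+1) → ℝ) : Prop :=
  (∀ e : V, ∀ j : Fin (k+1), j ≠ 0 → 0 ≤ x e j ∧ x e j ≤ 1) ∧
  (∀ e : V, ∑ j ∈ Finset.univ.erase (0 : Fin (k+1)), x e j ≤ 1)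

end KSubmodularDefs

section GreedyAnalysis

variable {V : Type*} {k : ℕ}

/-- `overlay o s` agrees with `s` on the support of `s` and with `o` elsewhere. -/
def overlay (o s : V → Fin (k+1)) : V → Fin (k+1) := fun e => if s e = 0 then o e else s e

/-- The total cost of the elements selected by `s` but not by `o`. -/
def costOutside [Fintype V] (c : V → ℝ) (o s : V → Fin (k+1)) : ℝ :=
  ∑ e ∈ univ.filter (fun e => s e ≠ 0 ∧ o e = 0), c e

/-- Splitting the costs of `s` and `o` over their common support. -/
lemma kcost_add_sum_eq [Fintype V] (c : V → ℝ) (o s : V → Fin (k+1)) :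
    kcost c s + ∑ e ∈ univ.filter (fun e => o e ≠ 0 ∧ s e = 0), c e
      = kcost c o + costOutside c o s := by
  simp only [kcost, costOutside, ksupp, sum_filter, ← sum_add_distrib]
  refine sum_congr rfl fun a _ => ?_
  by_cases h : s a = 0 <;> by_cases h' : o a = 0 <;> simp [h, h']

variable [DecidableEq V]

lemma kle_update {s : V → Fin (k+1)} {e : V} (he : s e = 0) (j : Fin (k+1)) :
    kle s (Function.update s e j) := by
  intro a
  by_cases h : a = e
  · subst h; exact Or.inl he
  · simp [h]

/-- Marginal gains diminish along `⪯`. -/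
lemma KSubmodular.margin_anti {f : (V → Fin (k+1)) → ℝ} (hsub : KSubmodular f)
    {s t : V → Fin (k+1)} (hst : kle s t) {e : V} (he : t e = 0) (j : Fin (k+1)) :
    margin f t e j ≤ margin f s e j := by
  have hse : s e = 0 := by rcases hst e with h | h <;> simp [h, he]
  have hsup : ksup (Function.update s e j) t = Function.update t e j := by
    funext a
    by_cases h : a = e
    · subst h; simp [ksup, he]
    · rcases hst a with h' | h' <;> simp [ksup, h, h'] <;> tauto
  have hinf : kinf (Function.update s e j) t = s := by
    funext a
    by_cases h : a = e
    · subst h; by_cases hj : j = 0 <;> simp [kinf, he, hse, hj]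
    · rcases hst a with h' | h' <;> simp [kinf, h, h']
  have := hsub (Function.update s e j) t
  rw [hsup, hinf] at this
  unfold margin
  linarith

lemma margin_nonneg {f : (V → Fin (k+1)) → ℝ} (hmono : KMonotone f)
    {s : V → Fin (k+1)} {e : V} (he : s e = 0) (j : Fin (k+1)) : 0 ≤ margin f s e j :=
  sub_nonneg.2 (hmono _ _ (kle_update he j))

lemma overlay_update (o s : V → Fin (k+1)) (e : V) {j : Fin (k+1)} (hj : j ≠ 0) :
    overlay o (Function.update s e j) = Function.update (overlay o s) e j := by
  funext a
  by_cases h : a = e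
  · subst h; simp [overlay, hj]
  · simp [overlay, h]

/-- Assigning a new element to `j` costs the overlay at most the gain of the best assignment. -/
lemma overlay_sub_le_margin {f : (V → Fin (k+1)) → ℝ} (hsub : KSubmodular f)
    (hmono : KMonotone f) (o : V → Fin (k+1)) {s : V → Fin (k+1)} {e : V} (he : s e = 0)
    {j : Fin (k+1)} (hj : j ≠ 0) :
    f (overlay o s) - f (overlay o (Function.update s e j)) ≤ margin f s e (o e) := by
  set q := Function.update (overlay o s) e 0 with hq
  have hqe : q e = 0 := by simp [hq]
  have hsq : kle s q := by
    intro a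
    by_cases h : a = e
    · subst h; exact Or.inl he
    · by_cases h' : s a = 0
      · exact Or.inl h'
      · right; simp [hq, h, overlay, h']
  have hm := hsub.margin_anti hsq hqe (o e)
  have hqo : Function.update q e (o e) = overlay o s := by
    have : overlay o s e = o e := by simp [overlay, he]
    rw [hq, Function.update_idem, ← this, Function.update_eq_self]
  have hle : f q ≤ f (Function.update q e j) := hmono _ _ (kle_update hqe j)
  rw [hq, Function.update_idem, ← overlay_update o s e hj, ← hq] at hle
  rw [margin, hqo] at hm
  linarith

variable [Fintype V]

lemma kcost_update (c : V → ℝ) {s : V → Fin (k+1)} {e : V} (he : s e = 0)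
    {j : Fin (k+1)} (hj : j ≠ 0) :
    kcost c (Function.update s e j) = kcost c s + c e := by
  have : ksupp (Function.update s e j) = insert e (ksupp s) := by
    ext a
    by_cases h : a = e
    · subst h; simp [ksupp, hj]
    · simp [ksupp, h]
  rw [kcost, this, sum_insert (by simp [ksupp, he]), kcost, add_comm]

lemma costOutside_update_of_eq_zero (c : V → ℝ) {o s : V → Fin (k+1)} {e : V} (he : s e = 0)
    (ho : o e = 0) {j : Fin (k+1)} (hj : j ≠ 0) :
    costOutside c o (Function.update s e j) = costOutside c o s + c e := by
  have : univ.filter (fun a => Function.update s e j a ≠ 0 ∧ o a = 0)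
      = insert e (univ.filter (fun a => s a ≠ 0 ∧ o a = 0)) := by
    ext a
    by_cases h : a = e
    · subst h; simp [hj, ho]
    · simp [h]
  rw [costOutside, this, sum_insert (by simp [he]), costOutside, add_comm]

lemma costOutside_update_of_ne_zero (c : V → ℝ) {o : V → Fin (k+1)} (s : V → Fin (k+1)) {e : V}
    (ho : o e ≠ 0) (j : Fin (k+1)) :
    costOutside c o (Function.update s e j) = costOutside c o s := by
  unfold costOutside
  congr 1
  ext a
  by_cases h : a = e
  · subst h; simp [ho]
  · simp [h]

/-- The gain of overlaying is at most the sum of the individual marginal gains. -/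
lemma KSubmodular.overlay_le {f : (V → Fin (k+1)) → ℝ} (hsub : KSubmodular f)
    (o s : V → Fin (k+1)) :
    f (overlay o s) ≤
      f s + ∑ e ∈ univ.filter (fun e => o e ≠ 0 ∧ s e = 0), margin f s e (o e) := by
  have key : ∀ T : Finset V, (∀ e ∈ T, s e = 0) →
      f (fun e => if e ∈ T then o e else s e) ≤ f s + ∑ e ∈ T, margin f s e (o e) := by
    intro T
    induction T using Finset.induction_on with
    | empty => simp
    | insert a T ha ih =>
      intro hT
      have hT' : ∀ e ∈ T, s e = 0 := fun e he => hT e (mem_insert_of_mem he)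
      have hle : kle s (fun e => if e ∈ T then o e else s e) := by
        intro e
        by_cases h : e ∈ T
        · exact Or.inl (hT' e h)
        · simp [h]
      have hm := hsub.margin_anti hle (e := a) (by simp [ha, hT a (mem_insert_self a T)]) (o a)
      have hupd : Function.update (fun e => if e ∈ T then o e else s e) a (o a)
          = fun e => if e ∈ insert a T then o e else s e := by
        funext e
        by_cases h : e = a
        · subst h; simp
        · simp [h]
      rw [margin, hupd] at hm
      rw [sum_insert ha]
      linarith [ih hT']
  have hov : overlay o s =
      fun e => if e ∈ univ.filter (fun e => o e ≠ 0 ∧ s e = 0) then o e else s e := by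
    funext e
    by_cases h : s e = 0 <;> by_cases h' : o e = 0 <;> simp [overlay, h, h']
  rw [hov]
  exact key _ (by simp)

lemma GreedyRun.le_out {f : (V → Fin (k+1)) → ℝ} {c : V → ℝ} {B : ℝ} (hmono : KMonotone f)
    {s out : V → Fin (k+1)} {V0 : Finset V} (hrun : GreedyRun f c B s V0 out)
    (hV0 : ∀ e ∈ V0, s e = 0) : f s ≤ f out := by
  induction hrun with
  | done s => exact le_rfl
  | take s V0 e j out he hj _ _ _ ih =>
    refine (hmono _ _ (kle_update (hV0 e he) j)).trans (ih fun a ha => ?_)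
    rw [Function.update_of_ne (ne_of_mem_erase ha)]
    exact hV0 a (mem_of_mem_erase ha)
  | skip s V0 e j out he hj _ _ _ ih =>
    exact ih fun a ha => hV0 a (mem_of_mem_erase ha)

lemma GreedyRun.kcost_le {f : (V → Fin (k+1)) → ℝ} {c : V → ℝ} {B : ℝ}
    {s out : V → Fin (k+1)} {V0 : Finset V} (hrun : GreedyRun f c B s V0 out)
    (hV0 : ∀ e ∈ V0, s e = 0) (hs : kcost c s ≤ B) : kcost c out ≤ B := by
  induction hrun with
  | done s => exact hs
  | take s V0 e j out he hj _ hfit _ ih =>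
    refine ih (fun a ha => ?_) (by rwa [kcost_update c (hV0 e he) hj])
    rw [Function.update_of_ne (ne_of_mem_erase ha)]
    exact hV0 a (mem_of_mem_erase ha)
  | skip s V0 e j out he hj _ _ _ ih =>
    exact ih (fun a ha => hV0 a (mem_of_mem_erase ha)) hs

/-- If `e` is selected by `o` but no longer fits next to `s`, the marginal gains of the other
elements of `o` are paid for by the gain `N` already collected outside `o`. -/
lemma sum_margin_le_of_not_fit {f : (V → Fin (k+1)) → ℝ} {c : V → ℝ} {B N M : ℝ}
    (hc : ∀ e, 0 < c e) {o s : V → Fin (k+1)} (ho : kcost c o ≤ B)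
    {e : V} (hoe : o e ≠ 0) (hse : s e = 0) (hnofit : ¬ kcost c s + c e ≤ B) (hN : 0 ≤ N)
    (hM : margin f s e (o e) ≤ M)
    (hdens : ∀ a, o a ≠ 0 → s a = 0 → margin f s a (o a) * costOutside c o s ≤ N * c a) :
    ∑ a ∈ univ.filter (fun a => o a ≠ 0 ∧ s a = 0), margin f s a (o a) ≤ N + M := by
  set T := univ.filter (fun a => o a ≠ 0 ∧ s a = 0) with hT
  have heT : e ∈ T := by simp [hT, hoe, hse]
  have hcost := kcost_add_sum_eq c o s
  rw [← hT, ← add_sum_erase T c heT] at hcost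
  have hD : ∑ a ∈ T.erase e, c a < costOutside c o s := by linarith
  have hD0 : 0 ≤ ∑ a ∈ T.erase e, c a := sum_nonneg fun a _ => (hc a).le
  have hS : (∑ a ∈ T.erase e, margin f s a (o a)) * costOutside c o s
      ≤ N * ∑ a ∈ T.erase e, c a := by
    rw [sum_mul, mul_sum]
    refine sum_le_sum fun a ha => ?_
    have := mem_of_mem_erase ha
    simp only [hT, mem_filter, mem_univ, true_and] at this
    exact hdens a this.1 this.2
  have hSN : ∑ a ∈ T.erase e, margin f s a (o a) ≤ N :=
    le_of_mul_le_mul_right (hS.trans (mul_le_mul_of_nonneg_left hD.le hN)) (hD0.trans_lt hD)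
  rw [← add_sum_erase T _ heT]
  linarith

/-- The main induction: `M` bounds every marginal gain of `o`, and `N` is the gain collected
from elements outside `o`. -/
lemma GreedyRun.le_two_mul {f : (V → Fin (k+1)) → ℝ} {c : V → ℝ} {B M : ℝ}
    (hsub : KSubmodular f) (hmono : KMonotone f) (hc : ∀ e, 0 < c e) {o : V → Fin (k+1)}
    (ho : kcost c o ≤ B) (hM : 0 ≤ M)
    {s out : V → Fin (k+1)} {V0 : Finset V} (hrun : GreedyRun f c B s V0 out)
    (hV0 : ∀ e ∈ V0, s e = 0) (hoV0 : ∀ e, o e ≠ 0 → s e = 0 → e ∈ V0)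
    (hmarg : ∀ e, o e ≠ 0 → s e = 0 → margin f s e (o e) ≤ M)
    {N : ℝ} (hN : 0 ≤ N) (hval : f o + M + N ≤ f (overlay o s) + f s)
    (hdens : ∀ a, o a ≠ 0 → s a = 0 → margin f s a (o a) * costOutside c o s ≤ N * c a) :
    f o ≤ 2 * f out := by
  induction hrun generalizing N with
  | done s =>
    have : overlay o s = s := by
      funext e
      by_cases hs : s e = 0
      · by_cases hoe : o e = 0
        · simp [overlay, hs, hoe]
        · simpa using hoV0 e hoe hs
      · simp [overlay, hs]
    rw [this] at hval
    linarith
  | take s V0 e j out he hj hbest hfit hrest ih =>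
    have hse := hV0 e he
    have hupd : ∀ a, Function.update s e j a = 0 → a ≠ e ∧ s a = 0 := by
      intro a ha
      by_cases h : a = e
      · subst h; simp [hj] at ha
      · exact ⟨h, by simpa [h] using ha⟩
    have hanti : ∀ a, Function.update s e j a = 0 →
        margin f (Function.update s e j) a (o a) ≤ margin f s a (o a) :=
      fun a ha => hsub.margin_anti (kle_update hse j) ha _
    have hV0' : ∀ a ∈ V0.erase e, Function.update s e j a = 0 := by
      intro a ha
      rw [Function.update_of_ne (ne_of_mem_erase ha)]
      exact hV0 a (mem_of_mem_erase ha)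
    have hoV0' : ∀ a, o a ≠ 0 → Function.update s e j a = 0 → a ∈ V0.erase e :=
      fun a hoa ha => mem_erase.2 ⟨(hupd a ha).1, hoV0 a hoa (hupd a ha).2⟩
    have hmarg' : ∀ a, o a ≠ 0 → Function.update s e j a = 0 →
        margin f (Function.update s e j) a (o a) ≤ M :=
      fun a hoa ha => (hanti a ha).trans (hmarg a hoa (hupd a ha).2)
    have hC : 0 ≤ costOutside c o s := sum_nonneg fun a _ => (hc a).le
    have hgain : f (Function.update s e j) = f s + margin f s e j := by simp [margin]
    have hloss := overlay_sub_le_margin hsub hmono o hse hj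
    by_cases hoe : o e = 0
    · refine ih hV0' hoV0' hmarg' (N := N + margin f s e j)
        (add_nonneg hN (margin_nonneg hmono hse j)) ?_ ?_
      · have : margin f s e (o e) = 0 := by
          rw [margin, hoe, ← hse, Function.update_eq_self, sub_self]
        linarith
      · intro a hoa ha
        have hsa := (hupd a ha).2
        rw [costOutside_update_of_eq_zero c hse hoe hj]
        have hb := hbest a (hoV0 a hoa hsa) (o a) hoa
        rw [div_le_div_iff₀ (hc a) (hc e)] at hb
        calc margin f (Function.update s e j) a (o a) * (costOutside c o s + c e)
            ≤ margin f s a (o a) * (costOutside c o s + c e) :=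
              mul_le_mul_of_nonneg_right (hanti a ha) (add_nonneg hC (hc e).le)
          _ ≤ (N + margin f s e j) * c a := by linarith [hdens a hoa hsa]
    · refine ih hV0' hoV0' hmarg' hN ?_ ?_
      · have hb := (div_le_div_iff_of_pos_right (hc e)).1 (hbest e he (o e) hoe)
        linarith
      · intro a hoa ha
        rw [costOutside_update_of_ne_zero c s hoe j]
        exact (mul_le_mul_of_nonneg_right (hanti a ha) hC).trans (hdens a hoa (hupd a ha).2)
  | skip s V0 e j out he hj hbest hnofit hrest ih =>
    have hV0' : ∀ a ∈ V0.erase e, s a = 0 := fun a ha => hV0 a (mem_of_mem_erase ha)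
    by_cases hoe : o e = 0
    · refine ih hV0' (fun a hoa ha => mem_erase.2 ⟨?_, hoV0 a hoa ha⟩) hmarg hN hval hdens
      rintro rfl
      exact hoa hoe
    · have hse := hV0 e he
      have hsum := sum_margin_le_of_not_fit hc ho hoe hse hnofit hN (hmarg e hoe hse) hdens
      linarith [hsub.overlay_le o s, hrest.le_out hmono hV0']

/-- A greedy run started from the most valuable singleton of `o` is a `1/2`-approximation
of `o`. -/
lemma GreedyRun.le_two_mul_of_single {f : (V → Fin (k+1)) → ℝ} {c : V → ℝ} {B : ℝ}
    (hsub : KSubmodular f) (hmono : KMonotone f) (hnonneg : ∀ x, 0 ≤ f x)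
    (hc : ∀ e, 0 < c e) {o : V → Fin (k+1)}
    (ho : kcost c o ≤ B) {i : V}
    (hmax : ∀ e, o e ≠ 0 →
      f (Function.update (fun _ => 0) e (o e)) ≤ f (Function.update (fun _ => 0) i (o i)))
    {out : V → Fin (k+1)}
    (hrun : GreedyRun f c B (Function.update (fun _ => 0) i (o i))
      (univ \ ksupp (Function.update (fun _ => 0) i (o i))) out) :
    f o ≤ 2 * f out := by
  set y : V → Fin (k+1) := Function.update (fun _ => 0) i (o i) with hy
  have hyo : ∀ e, y e ≠ 0 → y e = o e := by
    intro e
    by_cases h : e = i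
    · subst h; simp [hy]
    · simp [hy, h]
  have hov : overlay o y = o := by
    funext e
    by_cases h : y e = 0
    · simp [overlay, h]
    · simp [overlay, hyo e h]
  have hC : costOutside c o y = 0 := by
    refine sum_eq_zero fun e he => ?_
    simp only [mem_filter, mem_univ, true_and] at he
    exact absurd (hyo e he.1 ▸ he.2) he.1
  refine hrun.le_two_mul hsub hmono hc ho (hnonneg y) (by simp [ksupp]) ?_ ?_ le_rfl
    (N := 0) (by rw [hov]; linarith) (by simp [hC])
  · intro e _ he
    simp [ksupp, he]
  · intro e hoe he
    have hm := hsub.margin_anti (s := fun _ => 0) (fun _ => Or.inl rfl) he (o e)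
    have := hmax e hoe
    have h0 := hnonneg fun _ => 0
    rw [margin, margin] at hm
    rw [margin]
    linarith

end GreedyAnalysis

/-- The 1-Guess Greedy algorithm is a `1/2`-approximation for monotone
`k`-submodular maximization under a knapsack constraint: every output `s` (under arbitrary
tie-breaking, i.e. the best, w.r.t. `f`, among `0` and the greedy result `g y` for each
feasible singleton guess `y`) is feasible and satisfies `2·f(s) ≥ f(x)` for every feasible `x`. -/
theorem one_guess_greedy_monotone_half
    {V : Type*} [Fintype V] [DecidableEq V] {k : ℕ} (hk : 1 ≤ k)
    (f : (V → Fin (k+1)) → ℝ)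
    (hsub : KSubmodular f) (hmono : KMonotone f)
    (hnonneg : ∀ x : V → Fin (k+1), 0 ≤ f x) (hzero : f (fun _ => 0) = 0)
    (c : V → ℝ) (hc : ∀ e : V, 0 < c e) (B : ℝ) (hB : 0 < B)
    (g : (V → Fin (k+1)) → (V → Fin (k+1)))
    (hg : ∀ y : V → Fin (k+1), (ksupp y).card = 1 → kcost c y ≤ B →
      GreedyRun f c B y (Finset.univ \ ksupp y) (g y))
    (s : V → Fin (k+1))
    (hmem : s = (fun _ => 0) ∨
      ∃ y : V → Fin (k+1), (ksupp y).card = 1 ∧ kcost c y ≤ B ∧ s = g y)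
    (hbest0 : f (fun _ => 0) ≤ f s)
    (hbest : ∀ y : V → Fin (k+1), (ksupp y).card = 1 → kcost c y ≤ B → f (g y) ≤ f s) :
    kcost c s ≤ B ∧ ∀ x : V → Fin (k+1), kcost c x ≤ B → f x ≤ 2 * f s := by
  have hoff : ∀ y : V → Fin (k+1), ∀ e ∈ univ \ ksupp y, y e = 0 := by simp [ksupp]
  refine ⟨?_, fun x hx => ?_⟩
  · rcases hmem with rfl | ⟨y, hy, hyB, rfl⟩
    · simpa [kcost, ksupp] using hB.le
    · exact (hg y hy hyB).kcost_le (hoff y) hyB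
  · by_cases hne : (ksupp x).Nonempty
    · obtain ⟨i, hi, himax⟩ := exists_max_image (ksupp x)
        (fun e => f (Function.update (fun _ => 0) e (x e))) hne
      have hxi : x i ≠ 0 := by simpa [ksupp] using hi
      set y : V → Fin (k+1) := Function.update (fun _ => 0) i (x i) with hy
      have hysupp : ksupp y = {i} := by
        ext e
        by_cases h : e = i
        · subst h; simp [ksupp, hy, hxi]
        · simp [ksupp, hy, h]
      have hcard : (ksupp y).card = 1 := by rw [hysupp, card_singleton]
      have hyB : kcost c y ≤ B := by
        refine le_trans ?_ hx
        rw [kcost, hysupp]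
        exact sum_le_sum_of_subset_of_nonneg (singleton_subset_iff.2 hi) fun a _ _ => (hc a).le
      have := (hg y hcard hyB).le_two_mul_of_single hsub hmono hnonneg hc hx
        fun e he => himax e (by simpa [ksupp] using he)
      linarith [hbest y hcard hyB]
    · have hx0 : x = fun _ => 0 := by
        funext e
        by_contra h
        exact hne ⟨e, by simpa [ksupp] using h⟩
      rw [hx0, hzero]
      linarith [hnonneg s]
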